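/- arXiv:2501.06674 — 3 statements merged into one kernel-verified Lean document; each statement's English description precedes it below -/
import Mathlib

section
/- For every r ∈ (0,1) and every a ∈ ℂ, −(1/2)·Im( a · ∫_0^π ((r·e^{−iθ} − 1)³/(r·e^{−iθ} + 1)) · i·e^{iθ} dθ ) = −Im(a)·( (1 + r²) − 8r·arctanh r ) − 2π·Re(a)·r. (Note that r·e^{−iθ} + 1 ≠ 0 since 0 < r < 1.) -/
open Complex

/-- The real inverse hyperbolic tangent, `arctanh r = (1/2)·ln((1+r)/(1−r))`. -/
noncomputable def arctanh (r : ℝ) : ℝ := (1/2) * Real.log ((1 + r) / (1 - r))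

theorem one_add_mul_exp_mem_slitPlane {r : ℝ} (hr : r ∈ Set.Ioo (0:ℝ) 1) (θ : ℝ) :
    1 + (r : ℂ) * Complex.exp (-(Complex.I * (θ : ℂ))) ∈ slitPlane := by
  refine mem_slitPlane_of_norm_lt_one ?_
  have h : ‖Complex.exp (-(Complex.I * (θ : ℂ)))‖ = 1 := by simp [Complex.norm_exp]
  rw [norm_mul, h, mul_one, Complex.norm_real, Real.norm_of_nonneg hr.1.le]
  exact hr.2

theorem hasDerivAt_I03_primitive {r : ℝ} (hr : r ∈ Set.Ioo (0:ℝ) 1) (θ : ℝ) :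
    HasDerivAt (fun t : ℝ => -Complex.exp (Complex.I * (t : ℂ))
        - (r : ℂ) ^ 2 * Complex.exp (-(Complex.I * (t : ℂ))) + 4 * r * (Complex.I * (t : ℂ))
        + 8 * r * Complex.log (1 + (r : ℂ) * Complex.exp (-(Complex.I * (t : ℂ)))))
      ((((r : ℂ) * Complex.exp (-(Complex.I * (θ : ℂ))) - 1) ^ 3 /
          ((r : ℂ) * Complex.exp (-(Complex.I * (θ : ℂ))) + 1)) *
          (Complex.I * Complex.exp (Complex.I * (θ : ℂ)))) θ := by
  have hmem := one_add_mul_exp_mem_slitPlane hr θ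
  have hI : HasDerivAt (fun t : ℝ => Complex.I * (t : ℂ)) Complex.I θ := by
    simpa using (ofRealCLM.hasDerivAt (x := θ)).const_mul Complex.I
  have hneg := hI.fun_neg.cexp
  refine HasDerivAt.congr_deriv (((hI.cexp.fun_neg.fun_sub (hneg.const_mul ((r : ℂ) ^ 2))).fun_add
    (hI.const_mul (4 * (r : ℂ)))).fun_add
    ((((hneg.const_mul (r : ℂ)).const_add 1).clog_real hmem).const_mul (8 * (r : ℂ)))) ?_
  have hne := slitPlane_ne_zero hmem
  rw [Complex.exp_neg] at hne ⊢
  have hw := Complex.exp_ne_zero (Complex.I * (θ : ℂ))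
  generalize Complex.exp (Complex.I * (θ : ℂ)) = w at hne hw ⊢
  have hne' : w + r ≠ 0 := by
    intro h
    apply hne
    field_simp
    rw [h, mul_zero]
  have hne'' : (r : ℂ) + w ≠ 0 := by rwa [add_comm]
  field_simp
  ring

/-- Evaluation of the integral `I⁺₀,₃(r)`: for `r ∈ (0,1)` and `a ∈ ℂ`,
`−(1/2)·Im( a · ∫_0^π ((r·e^{−iθ}−1)³/(r·e^{−iθ}+1)) · i·e^{iθ} dθ )
  = −Im(a)·((1+r²) − 8r·arctanh r) − 2π·Re(a)·r`. -/
theorem I03_eval (r : ℝ) (hr : r ∈ Set.Ioo (0:ℝ) 1) (a : ℂ) :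
    -(1/2 : ℝ) * (a * ∫ θ in (0:ℝ)..Real.pi,
        (((r : ℂ) * Complex.exp (-(Complex.I * (θ : ℂ))) - 1) ^ 3 /
          ((r : ℂ) * Complex.exp (-(Complex.I * (θ : ℂ))) + 1)) *
          (Complex.I * Complex.exp (Complex.I * (θ : ℂ)))).im =
      -a.im * ((1 + r ^ 2) - 8 * r * arctanh r) - 2 * Real.pi * a.re * r := by
  have hint := intervalIntegral.integral_eq_sub_of_hasDerivAt (a := 0) (b := Real.pi)
    (fun θ _ => hasDerivAt_I03_primitive hr θ) (by
      refine Continuous.intervalIntegrable ?_ _ _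
      refine Continuous.mul (Continuous.div (by fun_prop) (by fun_prop) fun θ => ?_) (by fun_prop)
      rw [add_comm]
      exact slitPlane_ne_zero (one_add_mul_exp_mem_slitPlane hr θ))
  have hpi : Complex.exp (Complex.I * (Real.pi : ℂ)) = -1 := by
    rw [mul_comm, Complex.exp_pi_mul_I]
  have hr1 : 0 < 1 - r := sub_pos.mpr hr.2
  have hr2 : 0 < 1 + r := by linarith [hr.1]
  have hlog1 : Complex.log (1 + (r : ℂ) * (-1)⁻¹) = (Real.log (1 - r) : ℝ) := by
    rw [Complex.ofReal_log hr1.le]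
    congr 1
    push_cast
    norm_num
    ring
  have hlog2 : Complex.log (1 + (r : ℂ)) = (Real.log (1 + r) : ℝ) := by
    rw [Complex.ofReal_log hr2.le]
    push_cast
    rfl
  have hval : (∫ θ in (0:ℝ)..Real.pi,
        (((r : ℂ) * Complex.exp (-(Complex.I * (θ : ℂ))) - 1) ^ 3 /
          ((r : ℂ) * Complex.exp (-(Complex.I * (θ : ℂ))) + 1)) *
          (Complex.I * Complex.exp (Complex.I * (θ : ℂ)))) =
      ((2 + 2 * r ^ 2 - 16 * r * arctanh r : ℝ) : ℂ) + (4 * Real.pi * r : ℝ) * Complex.I := by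
    rw [hint, Complex.exp_neg, hpi, hlog1, arctanh, Real.log_div hr2.ne' hr1.ne']
    simp only [Complex.ofReal_zero, mul_zero, neg_zero, Complex.exp_zero, mul_one, hlog2]
    push_cast
    ring
  rw [hval, Complex.mul_im]
  simp only [Complex.add_re, Complex.add_im, Complex.ofReal_re, Complex.ofReal_im,
    Complex.re_ofReal_mul, Complex.im_ofReal_mul, Complex.I_re, Complex.I_im]
  ring
end

section
/- Let m ≥ 3 be an integer, let P be a real polynomial with deg P ≤ 2(m−2), and let α ∈ ℝ, with P and α not both zero. Define h : (0,1) → ℝ by h(r) = P(r) + α·r·(r²−1)^{m−3}·arctanh r. Then h has at most 2m−3 zeros in (0,1); that is, the set {r ∈ (0,1) : h(r) = 0} has at most 2m−3 elements. -/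
open Set in
/-- **Rolle's theorem**, counting zeros: a function has at most one more zero on an open interval
than its derivative. -/
theorem encard_zeros_le_encard_zeros_deriv_add_one {f f' : ℝ → ℝ} {a b : ℝ}
    (hf : ∀ x ∈ Ioo a b, HasDerivAt f (f' x) x) :
    {x ∈ Ioo a b | f x = 0}.encard ≤ {x ∈ Ioo a b | f' x = 0}.encard + 1 := by
  by_cases hfin : {x ∈ Ioo a b | f' x = 0}.Finite
  · obtain ⟨t, ht⟩ := hfin.exists_finset_coe
    rw [← ht, encard_coe_eq_coe_finsetCard]
    by_contra! hlt
    obtain ⟨s, hs, hcard⟩ := exists_subset_encard_eq (Order.add_one_le_of_lt hlt)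
    have hsfin : s.Finite := finite_of_encard_eq_coe (k := t.card + 1 + 1) (by simpa using hcard)
    lift s to Finset ℝ using hsfin
    have hle : s.card ≤ t.card + 1 := by
      refine Finset.card_le_of_interleaved fun x hx y hy hxy _ => ?_
      obtain ⟨hxI, hx0⟩ := hs hx
      obtain ⟨hyI, hy0⟩ := hs hy
      have hsub : Icc x y ⊆ Ioo a b := Icc_subset_Ioo hxI.1 hyI.2
      obtain ⟨z, hz, hz0⟩ := exists_hasDerivAt_eq_zero hxy
        (fun w hw => (hf w (hsub hw)).continuousAt.continuousWithinAt) (hx0.trans hy0.symm)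
        fun w hw => hf w (hsub (Ioo_subset_Icc_self hw))
      refine ⟨z, ?_, hz.1, hz.2⟩
      rw [← Finset.mem_coe, ht]
      exact ⟨hsub (Ioo_subset_Icc_self hz), hz0⟩
    rw [encard_coe_eq_coe_finsetCard] at hcard
    have : s.card = t.card + 1 + 1 := by exact_mod_cast hcard
    omega
  · rw [Set.Infinite.encard_eq hfin]
    simp

open Set in
/-- If the `N`-th derivative of `g 0` does not vanish on an open interval, then `g 0` has at most
`N` zeros there. -/
theorem encard_zeros_le_of_iterated_deriv_ne_zero {a b : ℝ} (N : ℕ) (g : ℕ → ℝ → ℝ)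
    (hg : ∀ j, ∀ x ∈ Ioo a b, HasDerivAt (g j) (g (j + 1) x) x)
    (hN : ∀ x ∈ Ioo a b, g N x ≠ 0) : {x ∈ Ioo a b | g 0 x = 0}.encard ≤ N := by
  induction N generalizing g with
  | zero =>
    have : {x ∈ Ioo a b | g 0 x = 0} = ∅ := by
      ext x
      simpa using fun h₁ h₂ => hN x ⟨h₁, h₂⟩
    rw [this, encard_empty]
    exact zero_le
  | succ N ih =>
    refine (encard_zeros_le_encard_zeros_deriv_add_one (hg 0)).trans ?_
    push_cast
    gcongr
    exact ih (fun j => g (j + 1)) (fun j => hg (j + 1)) hN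

theorem analyticAt_arctanh {x : ℝ} (hx : x ∈ Set.Ioo (0 : ℝ) 1) : AnalyticAt ℝ arctanh x := by
  have h₁ : (1 - x) ≠ 0 := by linarith [hx.2]
  have h₂ : 0 < (1 + x) / (1 - x) := div_pos (by linarith [hx.1]) (by linarith [hx.2])
  unfold arctanh
  have h₃ : AnalyticAt ℝ (fun r : ℝ => (1 + r) / (1 - r)) x := by fun_prop (disch := assumption)
  exact analyticAt_const.mul (h₃.log h₂)

theorem hasDerivAt_arctanh {x : ℝ} (hx : x ∈ Set.Ioo (0 : ℝ) 1) :
    HasDerivAt arctanh (1 / (1 - x ^ 2)) x := by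
  have h₁ : (1 - x) ≠ 0 := by linarith [hx.2]
  have h₁' : (1 + x) ≠ 0 := by linarith [hx.1]
  have h₂ : (1 + x) / (1 - x) ≠ 0 := div_ne_zero h₁' h₁
  have h := (((((hasDerivAt_id x).const_add 1).div ((hasDerivAt_id x).const_sub 1) h₁).log
    h₂).const_mul (1 / 2))
  refine h.congr_deriv ?_
  have h₃ : 1 - x ^ 2 ≠ 0 := by
    rw [show 1 - x ^ 2 = (1 - x) * (1 + x) by ring]
    exact mul_ne_zero h₁ h₁'
  simp only [id, Pi.div_apply]
  field_simp
  ring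

theorem hasDerivAt_const_div_one_sub_sq_pow (c : ℝ) (k : ℕ) {x : ℝ} (hx : 1 - x ^ 2 ≠ 0) :
    HasDerivAt (fun r : ℝ => c / (1 - r ^ 2) ^ k) (2 * k * c * x / (1 - x ^ 2) ^ (k + 1)) x := by
  have h := (hasDerivAt_const x c).div ((((hasDerivAt_id x).pow 2).const_sub 1).pow k)
    (pow_ne_zero k hx)
  refine h.congr_deriv ?_
  cases k with
  | zero => simp
  | succ k =>
    simp only [id, Pi.pow_apply, Nat.add_sub_cancel]
    push_cast
    field_simp
    ring

/-- If `w j` is the `j`-th derivative of a function on `(0,1)` whose `N`-th derivative is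
`c / (1 - r²) ^ k`, this computes the two following derivatives. -/
theorem two_derivs_of_eq_const_div {w : ℕ → ℝ → ℝ} {N k : ℕ} {c : ℝ}
    (hw : ∀ j, ∀ x ∈ Set.Ioo (0 : ℝ) 1, HasDerivAt (w j) (w (j + 1) x) x)
    (hN : ∀ x ∈ Set.Ioo (0 : ℝ) 1, w N x = c / (1 - x ^ 2) ^ k) :
    ∀ x ∈ Set.Ioo (0 : ℝ) 1, w (N + 1) x = 2 * k * c * x / (1 - x ^ 2) ^ (k + 1) ∧
      w (N + 2) x = 2 * k * c / (1 - x ^ 2) ^ (k + 1) +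
        x * (2 * (k + 1) * (2 * k * c) * x / (1 - x ^ 2) ^ (k + 2)) := by
  have hne : ∀ x ∈ Set.Ioo (0 : ℝ) 1, 1 - x ^ 2 ≠ 0 := fun x hx => by nlinarith [hx.1, hx.2]
  have hnext : ∀ {j : ℕ} {f : ℝ → ℝ} {f' x : ℝ}, x ∈ Set.Ioo (0 : ℝ) 1 →
      (∀ y ∈ Set.Ioo (0 : ℝ) 1, w j y = f y) → HasDerivAt f f' x → w (j + 1) x = f' :=
    fun hx hf hd => (hw _ _ hx).unique
      (hd.congr_of_eventuallyEq (Filter.eventuallyEq_of_mem (isOpen_Ioo.mem_nhds hx) hf))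
  have h₁ : ∀ x ∈ Set.Ioo (0 : ℝ) 1, w (N + 1) x = x * (2 * k * c / (1 - x ^ 2) ^ (k + 1)) :=
    fun x hx => (hnext hx hN (hasDerivAt_const_div_one_sub_sq_pow c k (hne x hx))).trans (by ring)
  refine fun x hx => ⟨(h₁ x hx).trans (by ring), ?_⟩
  have h := (hasDerivAt_id' x).mul
    (hasDerivAt_const_div_one_sub_sq_pow (2 * k * c) (k + 1) (hne x hx))
  refine (hnext hx h₁ h).trans ?_
  push_cast
  ring

/-- The derivatives of `(r² - 1) ^ n * arctanh r` on `(0,1)`: the one of order `2n+1` is a positive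
multiple of `1 / (1 - r²) ^ (n + 1)`. -/
theorem exists_derivs_sq_sub_one_pow_mul_arctanh (n : ℕ) :
    ∃ w : ℕ → ℝ → ℝ, ∃ c : ℝ, 0 < c ∧
      (∀ j, ∀ x ∈ Set.Ioo (0 : ℝ) 1, HasDerivAt (w j) (w (j + 1) x) x) ∧
      (∀ x, w 0 x = (x ^ 2 - 1) ^ n * arctanh x) ∧
      ∀ x ∈ Set.Ioo (0 : ℝ) 1, w (2 * n + 1) x = c / (1 - x ^ 2) ^ (n + 1) := by
  induction n with
  | zero =>
    refine ⟨fun j => deriv^[j] arctanh, 1, one_pos, fun j x hx => ?_, by simp, fun x hx => ?_⟩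
    · simp only [Function.iterate_succ_apply']
      exact ((analyticAt_arctanh hx).iterated_deriv j).differentiableAt.hasDerivAt
    · simpa using (hasDerivAt_arctanh hx).deriv
  | succ n ih =>
    obtain ⟨w, c, hc, hw, hw0, hwN⟩ := ih
    refine ⟨fun j x => (x ^ 2 - 1) * w j x + 2 * j * (x * w (j - 1) x) +
      j * (j - 1) * w (j - 2) x, 4 * (n + 1) ^ 2 * c, by positivity, fun j x hx => ?_,
      fun x => by simp [hw0]; ring, fun x hx => ?_⟩
    · have hsq : HasDerivAt (fun y : ℝ => y ^ 2 - 1) (2 * x) x := by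
        simpa using (hasDerivAt_pow 2 x).sub_const 1
      have h₀ := hsq.mul (hw j x hx)
      match j with
      | 0 =>
        exact (h₀.congr_deriv (by simp; ring)).congr_of_eventuallyEq (.of_forall fun y => by simp)
      | 1 =>
        have h := h₀.add (((hasDerivAt_id' x).mul (hw 0 x hx)).const_mul 2)
        exact (h.congr_deriv (by simp; ring)).congr_of_eventuallyEq (.of_forall fun y => by simp)
      | j + 2 =>
        have h := (h₀.add (((hasDerivAt_id' x).mul (hw (j + 1) x hx)).const_mul
          (2 * ((j : ℝ) + 2)))).add ((hw j x hx).const_mul (((j : ℝ) + 2) * (j + 1)))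
        exact (h.congr_deriv (by simp; ring)).congr_of_eventuallyEq
          (.of_forall fun y => by simp [-mul_eq_mul_right_iff]; ring)
    · obtain ⟨h₁, h₂⟩ := two_derivs_of_eq_const_div hw hwN x hx
      have hne : 1 - x ^ 2 ≠ 0 := by nlinarith [hx.1, hx.2]
      have e₁ : 2 * (n + 1) + 1 - 1 = 2 * n + 1 + 1 := by omega
      have e₂ : 2 * (n + 1) + 1 - 2 = 2 * n + 1 := by omega
      have e₃ : 2 * (n + 1) + 1 = 2 * n + 1 + 2 := by omega
      simp only [e₁, e₂]
      rw [e₃, h₁, h₂, hwN x hx]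
      push_cast
      field_simp
      ring

/-- For `m ≥ 3`, any nonzero function of the form `P(r) + α·r·(r²−1)^{m−3}·arctanh r`,
with `P` a real polynomial of degree at most `2(m−2)`, has at most `2m−3` zeros in `(0,1)`. -/
theorem holomorphic_span_zero_bound (m : ℕ) (hm : 3 ≤ m)
    (P : Polynomial ℝ) (hP : P.degree ≤ (2 * (m - 2) : ℕ)) (α : ℝ)
    (hne : ¬ (P = 0 ∧ α = 0)) :
    {r ∈ Set.Ioo (0:ℝ) 1 |
        P.eval r + α * r * (r ^ 2 - 1) ^ (m - 3) * arctanh r = 0}.encard ≤ 2 * m - 3 := by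
  obtain ⟨n, rfl⟩ := Nat.exists_eq_add_of_le' hm
  have hbound : (2 * ((n + 3 : ℕ) : ℕ∞) - 3) = ((2 * n + 3 : ℕ) : ℕ∞) := by
    norm_cast
  have hdeg : P.natDegree ≤ 2 * n + 2 :=
    Polynomial.natDegree_le_of_degree_le (hP.trans (by norm_cast))
  rw [hbound, Nat.add_sub_cancel]
  by_cases hα : α = 0
  · have hP0 : P ≠ 0 := fun h => hne ⟨h, hα⟩
    calc _ ≤ (P.roots.toFinset : Set ℝ).encard := by
          refine Set.encard_le_encard fun r hr => ?_
          simpa [hα, hP0] using hr.2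
      _ = P.roots.toFinset.card := Set.encard_coe_eq_coe_finsetCard _
      _ ≤ ((2 * n + 3 : ℕ) : ℕ∞) := by
          exact_mod_cast (Multiset.toFinset_card_le _).trans
            ((Polynomial.card_roots' P).trans (hdeg.trans (Nat.le_succ _)))
  · obtain ⟨w, c, hc, hw, hw0, hwN⟩ := exists_derivs_sq_sub_one_pow_mul_arctanh n
    have key := encard_zeros_le_of_iterated_deriv_ne_zero (a := 0) (b := 1) (2 * n + 3)
      (fun j x => (Polynomial.derivative^[j] P).eval x + α * (x * w j x + j * w (j - 1) x))
      (fun j x hx => ?_) (fun x hx => ?_)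
    · convert key using 5 with r
      simp [hw0]
      ring_nf
    · have hpoly : HasDerivAt (fun y => (Polynomial.derivative^[j] P).eval y)
          ((Polynomial.derivative^[j + 1] P).eval x) x := by
        rw [Function.iterate_succ_apply']
        exact Polynomial.hasDerivAt _ x
      have h₀ := (hasDerivAt_id' x).mul (hw j x hx)
      cases j with
      | zero =>
        exact ((hpoly.add (h₀.const_mul α)).congr_deriv (by simp [-mul_eq_mul_left_iff]; ring)).congr_of_eventuallyEq
          (.of_forall fun y => by simp)
      | succ j =>
        have h := hpoly.add ((h₀.add ((hw j x hx).const_mul ((j : ℝ) + 1))).const_mul α)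
        exact (h.congr_deriv (by simp [-mul_eq_mul_left_iff]; ring)).congr_of_eventuallyEq (.of_forall fun y => by simp)
    · obtain ⟨h₁, h₂⟩ := two_derivs_of_eq_const_div hw hwN x hx
      have hx0 : 0 < x := hx.1
      have hpos : 0 < 1 - x ^ 2 := by nlinarith [hx.1, hx.2]
      have hv₁ : 0 < w (2 * n + 2) x := by rw [h₁]; positivity
      have hv₂ : 0 < w (2 * n + 3) x := by rw [h₂]; positivity
      rw [Polynomial.iterate_derivative_eq_zero (by omega), Polynomial.eval_zero, zero_add]
      refine mul_ne_zero hα (ne_of_gt ?_)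
      rw [show 2 * n + 3 - 1 = 2 * n + 2 by omega]
      positivity
end

section
/- Let a, b, c, d, κ, ρ be real numbers and consider the real polynomials p(x) = a + b·x + c·x² + d·x³ and q(x) = c + (b + 2d − κ + ρ)·x + a·x² + (κ − d)·x³, and assume p ≠ 0 and q ≠ 0. Then the number of zeros of p in the open interval (0,1), counted with multiplicity, plus the number of zeros of q in (0,1), counted with multiplicity, is at most 5. -/
open Polynomial

open scoped Classical in
/-- The number of zeros of a real polynomial in the open interval `(0,1)`,
counted with multiplicity. -/
noncomputable def numZerosIn01 (p : Polynomial ℝ) : ℕ :=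
  (p.roots.filter (fun x => x ∈ Set.Ioo (0:ℝ) 1)).card

lemma numZerosIn01_le_natDegree (p : Polynomial ℝ) : numZerosIn01 p ≤ p.natDegree :=
  (Multiset.card_le_card (Multiset.filter_le _ _)).trans p.card_roots'

lemma natDegree_cubic_form_le (a b c d : ℝ) :
    (C a + C b * X + C c * X ^ 2 + C d * X ^ 3).natDegree ≤ 3 := by
  compute_degree

/-- A cubic with three zeros in `(0,1)` has its constant coefficient strictly smaller in absolute
value than its quadratic coefficient. -/
lemma abs_coeff_zero_lt_of_three_le_numZerosIn01 (a b c d : ℝ)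
    (h : 3 ≤ numZerosIn01 (C a + C b * X + C c * X ^ 2 + C d * X ^ 3)) : |a| < |c| := by
  classical
  set p : Polynomial ℝ := C a + C b * X + C c * X ^ 2 + C d * X ^ 3 with hp
  have hdeg : p.natDegree = 3 :=
    le_antisymm (natDegree_cubic_form_le a b c d) (h.trans (numZerosIn01_le_natDegree p))
  have hd : d ≠ 0 := by
    have hlead : p.coeff 3 ≠ 0 := by
      rw [← hdeg]
      exact leadingCoeff_ne_zero.mpr (by rintro h0; simp [h0] at hdeg)
    simpa [hp, coeff_X, coeff_C] using hlead
  have hfilter : p.roots.filter (fun x => x ∈ Set.Ioo (0 : ℝ) 1) = p.roots := by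
    refine Multiset.eq_of_le_of_card_le (Multiset.filter_le _ _) ?_
    refine (p.card_roots'.trans hdeg.le).trans (h.trans (le_of_eq ?_))
    unfold numZerosIn01
    congr!
  have hcard : p.roots.card = 3 :=
    le_antisymm (p.card_roots'.trans hdeg.le)
      (h.trans (Multiset.card_le_card (Multiset.filter_le _ _)))
  obtain ⟨x, y, z, hroots⟩ := Multiset.card_eq_three.mp hcard
  rw [Multiset.filter_eq_self, hroots] at hfilter
  obtain ⟨hx0, hx1⟩ := hfilter x (by simp)
  obtain ⟨hy0, hy1⟩ := hfilter y (by simp)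
  obtain ⟨hz0, hz1⟩ := hfilter z (by simp)
  let P : Cubic ℝ := ⟨d, c, b, a⟩
  have hP : (Cubic.map (RingHom.id ℝ) P).roots = {x, y, z} := by
    rw [← hroots, Cubic.map_roots, Polynomial.map_id]
    congr 1
    simp only [P, Cubic.toPoly, hp]
    ring
  have hc : c = d * -(x + y + z) := by
    simpa [P] using Cubic.b_eq_three_roots (φ := RingHom.id ℝ) (P := P) hd hP
  have ha : a = d * -(x * y * z) := by
    simpa [P] using Cubic.d_eq_three_roots (φ := RingHom.id ℝ) (P := P) hd hP
  have hxyz : x * y * z < x + y + z := by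
    have : x * y * z < x := by
      rw [mul_assoc]
      exact mul_lt_of_lt_one_right hx0 (mul_lt_one_of_nonneg_of_lt_one_left hy0.le hy1 hz1.le)
    linarith
  rw [ha, hc, abs_mul, abs_mul, abs_neg, abs_neg, abs_of_pos (by positivity : 0 < x * y * z),
    abs_of_pos (by positivity : 0 < x + y + z)]
  exact mul_lt_mul_of_pos_left hxyz (abs_pos.mpr hd)

/-- For nonzero `p(x) = a + bx + cx² + dx³` and
`q(x) = c + (b+2d−κ+ρ)x + ax² + (κ−d)x³`, they have at most 5 zeros in `(0,1)`
in total, counted with multiplicity. -/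
theorem zeros_m3 (a b c d κ ρ : ℝ)
    (hp : C a + C b * X + C c * X ^ 2 + C d * X ^ 3 ≠ 0)
    (hq : C c + C (b + 2 * d - κ + ρ) * X + C a * X ^ 2 + C (κ - d) * X ^ 3 ≠ 0) :
    numZerosIn01 (C a + C b * X + C c * X ^ 2 + C d * X ^ 3) +
      numZerosIn01 (C c + C (b + 2 * d - κ + ρ) * X + C a * X ^ 2 + C (κ - d) * X ^ 3) ≤ 5 := by
  by_contra! h
  have h₁ := (numZerosIn01_le_natDegree _).trans (natDegree_cubic_form_le a b c d)
  have h₂ := (numZerosIn01_le_natDegree _).trans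
    (natDegree_cubic_form_le c (b + 2 * d - κ + ρ) a (κ - d))
  exact lt_asymm (abs_coeff_zero_lt_of_three_le_numZerosIn01 a b c d (by omega))
    (abs_coeff_zero_lt_of_three_le_numZerosIn01 c (b + 2 * d - κ + ρ) a (κ - d) (by omega))
end
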